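/- Fix an integer U ≥ 2 and, for each u ∈ {1,…,U}, a symmetric positive definite matrix Λ_u ∈ ℝ^{2×2} with entries a_u = [Λ_u]_{1,1}, b_u = [Λ_u]_{1,2}, d_u = [Λ_u]_{2,2}. Let (μ_m, τ_m) be the state of the marginalized Gaussian Bayes recursion after m full iterations, started from an arbitrary mean vector μ_0 ∈ ℝ^{U+1} and arbitrary positive initial precisions τ_0 ∈ (0,∞)^{U+1}. Then (no further condition on the Λ_u beyond positive definiteness) the precisions grow linearly with explicit rates: τ_m^{(φ)}/m → Σ_{u=1}^U a_u and, for every u ∈ {1,…,U}, τ_m^{(u)}/m → d_u as m → ∞. -/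

import Mathlib

/-- One sub-iteration of the marginalized Gaussian Bayes recursion for unit `u`.
The state is a pair `(μ, τ)` where `μ : Fin (U+1) → ℝ` is the mean vector
(coordinate `0` for the shared parameter, coordinate `u.succ` for the `u`-th
unit-specific parameter) and `τ : Fin (U+1) → ℝ` is the vector of precisions.
The unit likelihood precision matrix is `Λ_u = !![a u, b u; b u, dd u]`. -/
noncomputable def subIter {U : ℕ} (a b dd : Fin U → ℝ) (u : Fin U)
    (st : (Fin (U + 1) → ℝ) × (Fin (U + 1) → ℝ)) :
    (Fin (U + 1) → ℝ) × (Fin (U + 1) → ℝ) :=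
  let μ := st.1
  let τ := st.2
  -- mean update matrix (diag(τ⁰, τᵘ) + Λᵤ)⁻¹ diag(τ⁰, τᵘ)
  let M : Matrix (Fin 2) (Fin 2) ℝ :=
    (!![τ 0 + a u, b u; b u, τ u.succ + dd u])⁻¹ * !![τ 0, 0; 0, τ u.succ]
  (fun i =>
      if i = 0 then M 0 0 * μ 0 + M 0 1 * μ u.succ
      else if i = u.succ then M 1 0 * μ 0 + M 1 1 * μ u.succ
      else μ i,
   fun i =>
      if i = 0 then τ 0 + a u - (b u) ^ 2 / (τ u.succ + dd u)
      else if i = u.succ then τ u.succ + dd u - (b u) ^ 2 / (τ 0 + a u)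
      else τ i)

/-- One full iteration of the marginalized Gaussian Bayes recursion: the
sub-iterations for units `u = 1, …, U` applied in order. -/
noncomputable def fullIter {U : ℕ} (a b dd : Fin U → ℝ)
    (st : (Fin (U + 1) → ℝ) × (Fin (U + 1) → ℝ)) :
    (Fin (U + 1) → ℝ) × (Fin (U + 1) → ℝ) :=
  (List.finRange U).foldl (fun s u => subIter a b dd u s) st


theorem tendsto_div_of_tendsto_sub {x : ℕ → ℝ} {L : ℝ}
    (h : Filter.Tendsto (fun m => x (m + 1) - x m) Filter.atTop (nhds L)) :
    Filter.Tendsto (fun m : ℕ => x m / m) Filter.atTop (nhds L) := by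
  have h1 := h.cesaro
  have h2 : Filter.Tendsto (fun m : ℕ => x 0 / m) Filter.atTop (nhds 0) :=
    tendsto_const_div_atTop_nhds_zero_nat _
  have h3 := h1.add h2
  rw [add_zero] at h3
  refine h3.congr fun m => ?_
  rw [Finset.sum_range_sub]
  ring

theorem tendsto_atTop_of_add_le_succ {x : ℕ → ℝ} {c : ℝ} (hc : 0 < c)
    (h : ∀ m, x m + c ≤ x (m + 1)) : Filter.Tendsto x Filter.atTop Filter.atTop := by
  have hx : ∀ m : ℕ, x 0 + m * c ≤ x m := by
    intro m
    induction m with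
    | zero => simp
    | succ k ih => push_cast; linarith [h k]
  refine Filter.tendsto_atTop_mono hx (Filter.tendsto_atTop_add_const_left _ _ ?_)
  exact tendsto_natCast_atTop_atTop.atTop_mul_const hc

theorem tendsto_const_div_add_zero {x : ℕ → ℝ} (hx : Filter.Tendsto x Filter.atTop Filter.atTop)
    (p q : ℝ) : Filter.Tendsto (fun m => p / (x m + q)) Filter.atTop (nhds 0) :=
  (Filter.tendsto_atTop_add_const_right _ q hx).const_div_atTop p

theorem sq_div_add_le_sq_div {d t : ℝ} (b : ℝ) (hd : 0 < d) (ht : 0 < t) :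
    b ^ 2 / (t + d) ≤ b ^ 2 / d :=
  div_le_div_of_nonneg_left (sq_nonneg b) hd (le_add_of_nonneg_left ht.le)

theorem sq_div_add_lt {a b d t : ℝ} (hd : 0 < d) (h : b ^ 2 < a * d) (ht : 0 < t) :
    b ^ 2 / (t + d) < a :=
  (sq_div_add_le_sq_div b hd ht).trans_lt ((div_lt_iff₀ hd).2 h)

section Precision

variable {U : ℕ} {a b d : Fin U → ℝ}

theorem subIter_precision_zero (u : Fin U) (s : (Fin (U + 1) → ℝ) × (Fin (U + 1) → ℝ)) :
    (subIter a b d u s).2 0 = s.2 0 + a u - b u ^ 2 / (s.2 u.succ + d u) := by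
  simp [subIter]

theorem subIter_precision_self (u : Fin U) (s : (Fin (U + 1) → ℝ) × (Fin (U + 1) → ℝ)) :
    (subIter a b d u s).2 u.succ = s.2 u.succ + d u - b u ^ 2 / (s.2 0 + a u) := by
  simp [subIter]

theorem subIter_precision_of_ne {u v : Fin U} (h : v ≠ u)
    (s : (Fin (U + 1) → ℝ) × (Fin (U + 1) → ℝ)) :
    (subIter a b d u s).2 v.succ = s.2 v.succ := by
  simp [subIter, h]

theorem subIter_precision_pos (ha : ∀ u, 0 < a u) (hd : ∀ u, 0 < d u)
    (hdet : ∀ u, b u ^ 2 < a u * d u) (u : Fin U)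
    {s : (Fin (U + 1) → ℝ) × (Fin (U + 1) → ℝ)} (hs : ∀ i, 0 < s.2 i) (i : Fin (U + 1)) :
    0 < (subIter a b d u s).2 i := by
  refine Fin.cases ?_ (fun v => ?_) i
  · have := sq_div_add_lt (hd u) (hdet u) (hs u.succ)
    rw [subIter_precision_zero]
    linarith [hs 0]
  · rcases eq_or_ne v u with rfl | h
    · have := sq_div_add_lt (ha v) ((hdet v).trans_eq (mul_comm _ _)) (hs 0)
      rw [subIter_precision_self]
      linarith [hs v.succ]
    · rw [subIter_precision_of_ne h]
      exact hs _

theorem foldl_subIter_precision_pos (ha : ∀ u, 0 < a u) (hd : ∀ u, 0 < d u)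
    (hdet : ∀ u, b u ^ 2 < a u * d u) (l : List (Fin U))
    {s : (Fin (U + 1) → ℝ) × (Fin (U + 1) → ℝ)} (hs : ∀ i, 0 < s.2 i) (i : Fin (U + 1)) :
    0 < (l.foldl (fun s u => subIter a b d u s) s).2 i := by
  induction l generalizing s with
  | nil => exact hs i
  | cons u l ih => exact ih (subIter_precision_pos ha hd hdet u hs)

theorem foldl_subIter_precision_of_notMem {l : List (Fin U)} {v : Fin U} (hv : v ∉ l)
    (s : (Fin (U + 1) → ℝ) × (Fin (U + 1) → ℝ)) :
    (l.foldl (fun s u => subIter a b d u s) s).2 v.succ = s.2 v.succ := by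
  induction l generalizing s with
  | nil => rfl
  | cons u l ih =>
    rw [List.mem_cons, not_or] at hv
    rw [List.foldl_cons, ih hv.2, subIter_precision_of_ne hv.1]

theorem foldl_subIter_precision_zero {l : List (Fin U)} (hl : l.Nodup)
    (s : (Fin (U + 1) → ℝ) × (Fin (U + 1) → ℝ)) :
    (l.foldl (fun s u => subIter a b d u s) s).2 0 =
      s.2 0 + (l.map fun u => a u - b u ^ 2 / (s.2 u.succ + d u)).sum := by
  induction l generalizing s with
  | nil => simp
  | cons u l ih =>
    rw [List.nodup_cons] at hl
    have hmap : (l.map fun v => a v - b v ^ 2 / ((subIter a b d u s).2 v.succ + d v)) =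
        l.map fun v => a v - b v ^ 2 / (s.2 v.succ + d v) := by
      refine List.map_congr_left fun v hv => ?_
      rw [subIter_precision_of_ne (ne_of_mem_of_not_mem hv hl.1)]
    rw [List.foldl_cons, ih hl.2, hmap, subIter_precision_zero, List.map_cons, List.sum_cons]
    ring

theorem foldl_subIter_precision_succ_mem_Icc (ha : ∀ u, 0 < a u) (hd : ∀ u, 0 < d u)
    (hdet : ∀ u, b u ^ 2 < a u * d u) {l : List (Fin U)} (hl : l.Nodup) {v : Fin U} (hv : v ∈ l)
    {s : (Fin (U + 1) → ℝ) × (Fin (U + 1) → ℝ)} (hs : ∀ i, 0 < s.2 i) :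
    (l.foldl (fun s u => subIter a b d u s) s).2 v.succ - s.2 v.succ ∈
      Set.Icc (d v - b v ^ 2 / (s.2 0 + a v)) (d v) := by
  induction l generalizing s with
  | nil => simp at hv
  | cons u l ih =>
    rw [List.nodup_cons] at hl
    rw [List.foldl_cons]
    rcases eq_or_ne v u with rfl | h
    · rw [foldl_subIter_precision_of_notMem hl.1, subIter_precision_self]
      have : 0 ≤ b v ^ 2 / (s.2 0 + a v) :=
        div_nonneg (sq_nonneg _) (add_pos (hs 0) (ha v)).le
      constructor <;> linarith
    · have key := ih hl.2 (List.mem_of_ne_of_mem h hv) (subIter_precision_pos ha hd hdet u hs)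
      rw [subIter_precision_of_ne h] at key
      refine ⟨le_trans (sub_le_sub_left ?_ _) key.1, key.2⟩
      have := sq_div_add_lt (hd u) (hdet u) (hs u.succ)
      refine div_le_div_of_nonneg_left (sq_nonneg _) (add_pos (hs 0) (ha v)) ?_
      rw [subIter_precision_zero]
      linarith

theorem fullIter_precision_zero (s : (Fin (U + 1) → ℝ) × (Fin (U + 1) → ℝ)) :
    (fullIter a b d s).2 0 = s.2 0 + ∑ u, (a u - b u ^ 2 / (s.2 u.succ + d u)) := by
  rw [fullIter, foldl_subIter_precision_zero (List.nodup_finRange U), Fin.sum_univ_def]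

theorem iterate_fullIter_precision_pos (ha : ∀ u, 0 < a u) (hd : ∀ u, 0 < d u)
    (hdet : ∀ u, b u ^ 2 < a u * d u) {s : (Fin (U + 1) → ℝ) × (Fin (U + 1) → ℝ)}
    (hs : ∀ i, 0 < s.2 i) (m : ℕ) (i : Fin (U + 1)) : 0 < ((fullIter a b d)^[m] s).2 i := by
  induction m generalizing i with
  | zero => exact hs i
  | succ m ih =>
    rw [Function.iterate_succ_apply']
    exact foldl_subIter_precision_pos ha hd hdet _ ih i

theorem tendsto_fullIter_precision_div (hU : 0 < U) (ha : ∀ u, 0 < a u) (hd : ∀ u, 0 < d u)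
    (hdet : ∀ u, b u ^ 2 < a u * d u) {s : (Fin (U + 1) → ℝ) × (Fin (U + 1) → ℝ)}
    (hs : ∀ i, 0 < s.2 i) :
    Filter.Tendsto (fun m : ℕ => ((fullIter a b d)^[m] s).2 0 / m) Filter.atTop
        (nhds (∑ u, a u)) ∧
      ∀ u, Filter.Tendsto (fun m : ℕ => ((fullIter a b d)^[m] s).2 u.succ / m) Filter.atTop
        (nhds (d u)) := by
  have : Nonempty (Fin U) := ⟨⟨0, hU⟩⟩
  have hpos := iterate_fullIter_precision_pos ha hd hdet hs
  have hzero (m : ℕ) : ((fullIter a b d)^[m + 1] s).2 0 - ((fullIter a b d)^[m] s).2 0 =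
      ∑ u, (a u - b u ^ 2 / (((fullIter a b d)^[m] s).2 u.succ + d u)) := by
    rw [Function.iterate_succ_apply', fullIter_precision_zero, add_sub_cancel_left]
  have hsucc (u : Fin U) (m : ℕ) :
      ((fullIter a b d)^[m + 1] s).2 u.succ - ((fullIter a b d)^[m] s).2 u.succ ∈
        Set.Icc (d u - b u ^ 2 / (((fullIter a b d)^[m] s).2 0 + a u)) (d u) := by
    rw [Function.iterate_succ_apply']
    exact foldl_subIter_precision_succ_mem_Icc ha hd hdet (List.nodup_finRange U)
      (List.mem_finRange u) (hpos m)
  have hzero_top : Filter.Tendsto (fun m => ((fullIter a b d)^[m] s).2 0)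
      Filter.atTop Filter.atTop := by
    have hc : 0 < ∑ u, (a u - b u ^ 2 / d u) :=
      Finset.sum_pos (fun u _ => sub_pos.2 ((div_lt_iff₀ (hd u)).2 (hdet u)))
        Finset.univ_nonempty
    refine tendsto_atTop_of_add_le_succ hc fun m => ?_
    have hle : ∑ u, (a u - b u ^ 2 / d u) ≤
        ∑ u, (a u - b u ^ 2 / (((fullIter a b d)^[m] s).2 u.succ + d u)) :=
      Finset.sum_le_sum fun u _ =>
        sub_le_sub_left (sq_div_add_le_sq_div (b u) (hd u) (hpos m u.succ)) _
    linarith [hzero m]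
  have hsucc_top (u : Fin U) : Filter.Tendsto (fun m => ((fullIter a b d)^[m] s).2 u.succ)
      Filter.atTop Filter.atTop := by
    have hc : 0 < d u - b u ^ 2 / a u :=
      sub_pos.2 ((div_lt_iff₀ (ha u)).2 ((hdet u).trans_eq (mul_comm _ _)))
    refine tendsto_atTop_of_add_le_succ hc fun m => ?_
    linarith [(hsucc u m).1, sq_div_add_le_sq_div (b u) (ha u) (hpos m 0)]
  refine ⟨tendsto_div_of_tendsto_sub ?_, fun u => tendsto_div_of_tendsto_sub ?_⟩
  · simp only [hzero]
    refine tendsto_finsetSum _ fun u _ => ?_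
    simpa using (tendsto_const_div_add_zero (hsucc_top u) (b u ^ 2) (d u)).const_sub (a u)
  · refine tendsto_of_tendsto_of_tendsto_of_le_of_le ?_ tendsto_const_nhds
      (fun m => (hsucc u m).1) (fun m => (hsucc u m).2)
    simpa using (tendsto_const_div_add_zero hzero_top (b u ^ 2) (a u)).const_sub (d u)

end Precision

/-- Without any condition on the positive definite unit precision matrices beyond
positive definiteness, the precisions of the marginalized Gaussian Bayes recursion
grow linearly with explicit rates: `τ_m^{(φ)}/m → Σ_u a_u` and `τ_m^{(u)}/m → d_u`. -/
theorem marginalized_bayes_precision_rates {U : ℕ} (hU : 2 ≤ U)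
    (Λ : Fin U → Matrix (Fin 2) (Fin 2) ℝ)
    (hsymm : ∀ u, (Λ u).IsSymm) (hpd : ∀ u, (Λ u).PosDef)
    (μ0 τ0 : Fin (U + 1) → ℝ) (hτ0 : ∀ i, 0 < τ0 i) :
    Filter.Tendsto
      (fun m : ℕ =>
        ((fullIter (fun u => Λ u 0 0) (fun u => Λ u 0 1) (fun u => Λ u 1 1))^[m]
          (μ0, τ0)).2 0 / m)
      Filter.atTop (nhds (∑ u, Λ u 0 0)) ∧
    ∀ u : Fin U,
      Filter.Tendsto
        (fun m : ℕ =>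
          ((fullIter (fun u => Λ u 0 0) (fun u => Λ u 0 1) (fun u => Λ u 1 1))^[m]
            (μ0, τ0)).2 u.succ / m)
        Filter.atTop (nhds (Λ u 1 1)) := by
  refine tendsto_fullIter_precision_div (by omega) (fun u => (hpd u).diag_pos)
    (fun u => (hpd u).diag_pos) (fun u => ?_) hτ0
  have hdet := (hpd u).det_pos
  rw [Matrix.det_fin_two, (hsymm u).apply 0 1] at hdet
  linarith [sq (Λ u 0 1)]
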